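/- Let ρ≥1, ε≥0, and let P, P̃ be two probability measures on ℝ^d such that ∫|x|^{ρ(1+ε)}P(dx)+∫|y|^{ρ(1+ε)}P̃(dy)<∞. Let (ψ,ψ̃) be a pair of Kantorovich potentials associated with W_ρ(P,P̃). Then ψ∈L^{1+ε}(P), ψ̃∈L^{1+ε}(P̃), and max(𝒱^{1+ε}_P(ψ), 𝒱^{1+ε}_{P̃}(ψ̃)) ≤ 2^{ρ(1+ε)}( ∫|x|^{ρ(1+ε)}P(dx)+∫|y|^{ρ(1+ε)}P̃(dy) ). -/

import Mathlib

open MeasureTheory Set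

/-- `π` is a coupling of `P` and `Q`. -/
def IsCoupling {E : Type*} [MeasurableSpace E] (π : Measure (E × E)) (P Q : Measure E) : Prop :=
  π.map Prod.fst = P ∧ π.map Prod.snd = Q

/-- `wassersteinPow ρ P Q = W_ρ^ρ(P, Q)`. -/
noncomputable def wassersteinPow {E : Type*} [MeasurableSpace E] [NormedAddCommGroup E]
    (ρ : ℝ) (P Q : Measure E) : ℝ :=
  sInf {c : ℝ | ∃ π : Measure (E × E), IsCoupling π P Q ∧ c = ∫ p, ‖p.1 - p.2‖ ^ ρ ∂π}

/-- `(ψ, ψt)` is a pair of Kantorovich potentials associated with `W_ρ(P, Q)`: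
each is integrable, they are conjugate ρ-transforms of each other, and they achieve
the dual value `W_ρ^ρ(P,Q) = -∫ψ dP - ∫ψt dQ`. -/
def IsKantorovichPair {E : Type*} [MeasurableSpace E] [NormedAddCommGroup E]
    (ρ : ℝ) (P Q : Measure E) (ψ ψt : E → ℝ) : Prop :=
  Integrable ψ P ∧ Integrable ψt Q ∧
  (∀ x, ψ x = - ⨅ y : E, (‖x - y‖ ^ ρ + ψt y)) ∧
  (∀ y, ψt y = - ⨅ x : E, (‖x - y‖ ^ ρ + ψ x)) ∧
  wassersteinPow ρ P Q = - ∫ x, ψ x ∂P - ∫ y, ψt y ∂Q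

section RealPowers

theorem add_rpow_le_two_rpow_mul_add {a b p : ℝ} (ha : 0 ≤ a) (hb : 0 ≤ b) (hp : 1 ≤ p) :
    (a + b) ^ p ≤ 2 ^ (p - 1) * (a ^ p + b ^ p) := by
  lift a to NNReal using ha
  lift b to NNReal using hb
  exact_mod_cast NNReal.rpow_add_le_mul_rpow_add_rpow a b hp

theorem le_one_add_rpow {t q : ℝ} (ht : 0 ≤ t) (hq : 1 ≤ q) : t ≤ 1 + t ^ q := by
  rcases le_total t 1 with h | h
  · linarith [Real.rpow_nonneg ht q]
  · linarith [Real.self_le_rpow_of_one_le h hq]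

/-- Tangent line inequality for `t ↦ t ^ q`. -/
theorem rpow_le_rpow_add_mul_sub {a b q : ℝ} (ha : 0 ≤ a) (hab : a ≤ b) (hq : 1 ≤ q) :
    b ^ q ≤ a ^ q + q * b ^ (q - 1) * (b - a) := by
  rcases (ha.trans hab).eq_or_lt with rfl | hb
  · obtain rfl : a = 0 := le_antisymm hab ha
    simp
  have h1 := one_add_mul_self_le_rpow_one_add (s := a / b - 1)
    (by linarith [div_nonneg ha hb.le]) hq
  rw [add_sub_cancel, Real.div_rpow ha hb.le, le_div_iff₀ (Real.rpow_pos_of_pos hb q)] at h1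
  have h2 : b ^ q = b ^ (q - 1) * b := by
    rw [Real.rpow_sub_one hb.ne']
    field_simp
  have h3 : (1 + q * (a / b - 1)) * b ^ q = b ^ q - q * b ^ (q - 1) * (b - a) := by
    rw [h2]
    field_simp
    ring
  linarith

/-- The function `t ↦ min (max t 0) K ^ q` is Lipschitz with constant `q * K ^ (q - 1)`. -/
theorem truncated_rpow_add_le {a b d K q : ℝ} (hb : b ≤ d + a) (hd : 0 ≤ d) (hK : 0 ≤ K)
    (hq : 1 ≤ q) :
    min (max b 0) K ^ q ≤ min (max a 0) K ^ q + q * K ^ (q - 1) * d := by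
  have hA : 0 ≤ min (max a 0) K := le_min (le_max_right _ _) hK
  have hB : 0 ≤ min (max b 0) K := le_min (le_max_right _ _) hK
  have hL : 0 ≤ q * K ^ (q - 1) := mul_nonneg (by linarith) (Real.rpow_nonneg hK _)
  rcases le_total (min (max b 0) K) (min (max a 0) K) with h | h
  · have := Real.rpow_le_rpow hB h (by linarith : 0 ≤ q)
    nlinarith [mul_nonneg hL hd]
  · have h1 := rpow_le_rpow_add_mul_sub hA h hq
    have h2 : min (max b 0) K ^ (q - 1) ≤ K ^ (q - 1) :=
      Real.rpow_le_rpow hB (min_le_right _ _) (by linarith)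
    have h3 : min (max b 0) K - min (max a 0) K ≤ d := by
      have h4 : max b 0 ≤ max a 0 + d := max_le (by linarith [le_max_left a 0])
        (by linarith [le_max_right a 0])
      rw [sub_le_iff_le_add]
      rcases le_total (max a 0) K with h5 | h5
      · rw [min_eq_left h5]
        linarith [min_le_left (max b 0) K]
      · rw [min_eq_right h5]
        linarith [min_le_right (max b 0) K]
    have h4 : q * min (max b 0) K ^ (q - 1) * (min (max b 0) K - min (max a 0) K)
        ≤ q * K ^ (q - 1) * d := by
      apply mul_le_mul _ h3 (sub_nonneg.2 h) hL
      exact mul_le_mul_of_nonneg_left h2 (by linarith)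
    linarith

end RealPowers

section DualPotentials

open Filter Topology

variable {X Y : Type*} [MeasurableSpace X] [MeasurableSpace Y]

/-- Averaging the dual constraint over the second variable bounds one sided deviations. -/
theorem ae_rpow_negPart_le {P : Measure X} {Q : Measure Y} [IsProbabilityMeasure P]
    [IsProbabilityMeasure Q] {q : ℝ} (hq : 1 ≤ q) {c : X × Y → ℝ} (hc0 : ∀ z, 0 ≤ c z)
    (hc : Integrable c (P.prod Q)) (hcq : Integrable (fun z => c z ^ q) (P.prod Q))
    {f : X → ℝ} {g : Y → ℝ} (hg : Integrable g Q) (h : ∀ x y, 0 ≤ c (x, y) + f x + g y) :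
    ∀ᵐ x ∂P, max (-f x - ∫ y, g y ∂Q) 0 ^ q ≤ ∫ y, c (x, y) ^ q ∂Q := by
  filter_upwards [hc.prod_right_ae, hcq.prod_right_ae] with x h1 h2
  have hA : 0 ≤ ∫ y, c (x, y) ∂Q := integral_nonneg fun y => hc0 _
  have hle : -f x - ∫ y, g y ∂Q ≤ ∫ y, c (x, y) ∂Q := by
    have h3 : ∫ y, (-f x - g y) ∂Q ≤ ∫ y, c (x, y) ∂Q :=
      integral_mono ((integrable_const _).sub hg) h1 fun y => by
        have := h x y
        simp only
        linarith
    rwa [integral_sub (integrable_const _) hg, integral_const, probReal_univ, one_smul] at h3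
  have hJ : (∫ y, c (x, y) ∂Q) ^ q ≤ ∫ y, c (x, y) ^ q ∂Q :=
    (convexOn_rpow hq).map_integral_le
      (continuousOn_id.rpow_const fun _ _ => Or.inr (by linarith)) isClosed_Ici
      (ae_of_all _ fun y => hc0 _) h1 h2
  exact (Real.rpow_le_rpow (le_max_right _ _) (max_le hle hA) (by linarith)).trans hJ

/-- A function whose truncated powers have uniformly bounded integrals has integrable power. -/
theorem integrable_rpow_of_truncated {P : Measure X} [IsFiniteMeasure P] {q C : ℝ} (hq : 1 ≤ q)
    {u : X → ℝ} (hu : AEStronglyMeasurable u P)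
    (hC : ∀ n : ℕ, ∫ x, min (max (u x) 0) n ^ q ∂P ≤ C) :
    Integrable (fun x => max (u x) 0 ^ q) P ∧ ∫ x, max (u x) 0 ^ q ∂P ≤ C := by
  have hq0 : 0 ≤ q := by linarith
  have hpos : AEStronglyMeasurable (fun x => max (u x) 0 ^ q) P :=
    (Real.continuous_rpow_const hq0).comp_aestronglyMeasurable
      (hu.sup aestronglyMeasurable_const)
  have hnn : ∀ (n : ℕ) x, 0 ≤ min (max (u x) 0) (n : ℝ) := fun n x =>
    le_min (le_max_right _ _) n.cast_nonneg
  have hmeas : ∀ n : ℕ, AEStronglyMeasurable (fun x => min (max (u x) 0) (n : ℝ) ^ q) P :=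
    fun n => (Real.continuous_rpow_const hq0).comp_aestronglyMeasurable
      ((hu.sup aestronglyMeasurable_const).inf aestronglyMeasurable_const)
  have hint : ∀ n : ℕ, Integrable (fun x => min (max (u x) 0) (n : ℝ) ^ q) P := fun n =>
    Integrable.of_bound (hmeas n) ((n : ℝ) ^ q) (ae_of_all _ fun x => by
      rw [Real.norm_of_nonneg (Real.rpow_nonneg (hnn n x) q)]
      exact Real.rpow_le_rpow (hnn n x) (min_le_right _ _) hq0)
  have hlim : ∀ x, Tendsto (fun n : ℕ => ENNReal.ofReal (min (max (u x) 0) (n : ℝ) ^ q)) atTop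
      (𝓝 (ENNReal.ofReal (max (u x) 0 ^ q))) := fun x => by
    apply tendsto_const_nhds.congr'
    obtain ⟨N, hN⟩ := exists_nat_ge (max (u x) 0)
    filter_upwards [eventually_ge_atTop N] with n hn
    rw [min_eq_left (hN.trans (by exact_mod_cast hn))]
  have hC0 : 0 ≤ C := (integral_nonneg fun x => Real.rpow_nonneg (hnn 0 x) q).trans (hC 0)
  have hbound : ∫⁻ x, ENNReal.ofReal (max (u x) 0 ^ q) ∂P ≤ ENNReal.ofReal C := by
    calc ∫⁻ x, ENNReal.ofReal (max (u x) 0 ^ q) ∂P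
        = ∫⁻ x, liminf (fun n : ℕ => ENNReal.ofReal (min (max (u x) 0) (n : ℝ) ^ q)) atTop ∂P :=
          lintegral_congr fun x => (hlim x).liminf_eq.symm
      _ ≤ liminf (fun n : ℕ => ∫⁻ x, ENNReal.ofReal (min (max (u x) 0) (n : ℝ) ^ q) ∂P) atTop :=
          lintegral_liminf_le' fun n => (hmeas n).aemeasurable.ennreal_ofReal
      _ ≤ liminf (fun _ : ℕ => ENNReal.ofReal C) atTop := by
          refine liminf_le_liminf (Eventually.of_forall fun n => ?_)
          rw [← ofReal_integral_eq_lintegral_ofReal (hint n)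
            (ae_of_all _ fun x => Real.rpow_nonneg (hnn n x) q)]
          exact ENNReal.ofReal_le_ofReal (hC n)
      _ = ENNReal.ofReal C := liminf_const _
  have hnn' : 0 ≤ᵐ[P] fun x => max (u x) 0 ^ q :=
    ae_of_all _ fun x => Real.rpow_nonneg (le_max_right _ _) q
  refine ⟨⟨hpos, ?_⟩, ?_⟩
  · rw [hasFiniteIntegral_iff_ofReal hnn']
    exact hbound.trans_lt ENNReal.ofReal_lt_top
  · rw [integral_eq_lintegral_of_nonneg_ae hnn' hpos]
    exact ENNReal.toReal_le_of_le_ofReal hC0 hbound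

/-- If dual potentials are optimal up to arbitrarily small errors, their centered `q`-th moments
are controlled by the `q`-th moment of the cost under the product measure. -/
theorem centered_moment_le_of_dual {P : Measure X} {Q : Measure Y} [IsProbabilityMeasure P]
    [IsProbabilityMeasure Q] {q : ℝ} (hq : 1 ≤ q) {c : X × Y → ℝ} (hc0 : ∀ z, 0 ≤ c z)
    (hc : Integrable c (P.prod Q)) (hcq : Integrable (fun z => c z ^ q) (P.prod Q))
    {f : X → ℝ} {g : Y → ℝ} (hf : Integrable f P) (hg : Integrable g Q)
    (h : ∀ x y, 0 ≤ c (x, y) + f x + g y)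
    (hopt : ∀ δ > 0, ∃ π : Measure (X × Y), MeasurePreserving Prod.fst π P ∧
      MeasurePreserving Prod.snd π Q ∧ Integrable c π ∧
      ∫ z, c z ∂π ≤ - ∫ x, f x ∂P - ∫ y, g y ∂Q + δ) :
    Integrable (fun x => |f x - ∫ z, f z ∂P| ^ q) P ∧
      ∫ x, |f x - ∫ z, f z ∂P| ^ q ∂P ≤ 2 * ∫ z, c z ^ q ∂(P.prod Q) := by
  have hq0 : 0 ≤ q := by linarith
  set m := ∫ x, f x ∂P
  set k := ∫ y, g y ∂Q
  have hW : 0 ≤ -m - k := by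
    refine le_of_forall_pos_le_add fun δ hδ => ?_
    obtain ⟨π, -, -, -, hπ⟩ := hopt δ hδ
    exact (integral_nonneg hc0).trans hπ
  have hneg := ae_rpow_negPart_le hq hc0 hc hcq hg h
  have hneg' : ∀ᵐ y ∂Q, max (-g y - m) 0 ^ q ≤ ∫ x, c (x, y) ^ q ∂P :=
    ae_rpow_negPart_le (c := c ∘ Prod.swap) hq (fun z => hc0 _) hc.swap hcq.swap hf
      fun y x => by
        have := h x y
        simp only [Function.comp_apply, Prod.swap_prod_mk]
        linarith
  have hA : ∫ x, ∫ y, c (x, y) ^ q ∂Q ∂P = ∫ z, c z ^ q ∂(P.prod Q) :=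
    (integral_prod _ hcq).symm
  have hB : ∫ y, ∫ x, c (x, y) ^ q ∂P ∂Q = ∫ z, c z ^ q ∂(P.prod Q) :=
    (integral_prod_symm _ hcq).symm
  have hu : AEStronglyMeasurable (fun x => f x - m) P :=
    hf.aestronglyMeasurable.sub aestronglyMeasurable_const
  have hv : AEStronglyMeasurable (fun y => -g y - m) Q :=
    hg.aestronglyMeasurable.neg.sub aestronglyMeasurable_const
  have hnn : ∀ (n : ℕ) (t : ℝ), 0 ≤ min (max t 0) (n : ℝ) := fun n t =>
    le_min (le_max_right _ _) n.cast_nonneg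
  have hcont : ∀ n : ℕ, Continuous fun t : ℝ => min (max t 0) (n : ℝ) ^ q := fun n =>
    (Real.continuous_rpow_const hq0).comp (by fun_prop)
  have htrunc : ∀ (n : ℕ) (t : ℝ), ‖min (max t 0) (n : ℝ) ^ q‖ ≤ (n : ℝ) ^ q := fun n t => by
    rw [Real.norm_of_nonneg (Real.rpow_nonneg (hnn n t) q)]
    exact Real.rpow_le_rpow (hnn n t) (min_le_right _ _) hq0
  have hpos : ∀ n : ℕ, ∫ x, min (max (f x - m) 0) (n : ℝ) ^ q ∂P ≤ ∫ z, c z ^ q ∂(P.prod Q) := by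
    intro n
    have hmP := (hcont n).comp_aestronglyMeasurable hu
    have hmQ := (hcont n).comp_aestronglyMeasurable hv
    have hiP : Integrable (fun x => min (max (f x - m) 0) (n : ℝ) ^ q) P :=
      Integrable.of_bound hmP _ (ae_of_all _ fun x => htrunc n _)
    have hiQ : Integrable (fun y => min (max (-g y - m) 0) (n : ℝ) ^ q) Q :=
      Integrable.of_bound hmQ _ (ae_of_all _ fun x => htrunc n _)
    set L := q * (n : ℝ) ^ (q - 1)
    have hL0 : 0 ≤ L := mul_nonneg hq0 (Real.rpow_nonneg n.cast_nonneg _)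
    have hQle : ∫ y, min (max (-g y - m) 0) (n : ℝ) ^ q ∂Q ≤ ∫ z, c z ^ q ∂(P.prod Q) := by
      rw [← hB]
      refine integral_mono_ae hiQ hcq.integral_prod_right ?_
      filter_upwards [hneg'] with y hy
      exact (Real.rpow_le_rpow (hnn n _) (min_le_left _ _) hq0).trans hy
    refine le_of_forall_pos_le_add fun δ hδ => ?_
    obtain ⟨π, h1, h2, hcπ, hπ⟩ := hopt (δ / (L + 1)) (by positivity)
    have hfπ : Integrable (fun z : X × Y => f z.1) π :=
      (h1.integrable_comp hf.aestronglyMeasurable).2 hf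
    have hgπ : Integrable (fun z : X × Y => g z.2) π :=
      (h2.integrable_comp hg.aestronglyMeasurable).2 hg
    have iP : ∀ F : X → ℝ, AEStronglyMeasurable F P → ∫ z, F z.1 ∂π = ∫ x, F x ∂P := by
      intro F hF
      rw [← h1.map_eq] at hF ⊢
      exact (integral_map h1.aemeasurable hF).symm
    have iQ : ∀ F : Y → ℝ, AEStronglyMeasurable F Q → ∫ z, F z.2 ∂π = ∫ x, F x ∂Q := by
      intro F hF
      rw [← h2.map_eq] at hF ⊢
      exact (integral_map h2.aemeasurable hF).symm
    have hD : ∫ z, (c z + f z.1 + g z.2) ∂π ≤ δ / (L + 1) := by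
      rw [integral_add (f := fun z => c z + f z.1) (hcπ.add hfπ) hgπ, integral_add hcπ hfπ,
        iP f hf.aestronglyMeasurable,
        iQ g hg.aestronglyMeasurable]
      linarith
    have hiPπ : Integrable (fun z : X × Y => min (max (f z.1 - m) 0) (n : ℝ) ^ q) π :=
      (h1.integrable_comp hmP).2 hiP
    have hiQπ : Integrable (fun z : X × Y => min (max (-g z.2 - m) 0) (n : ℝ) ^ q) π :=
      (h2.integrable_comp hmQ).2 hiQ
    have hDi : Integrable (fun z : X × Y => L * (c z + f z.1 + g z.2)) π :=
      ((hcπ.add hfπ).add hgπ).const_mul L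
    have hkey : ∫ z, min (max (f z.1 - m) 0) (n : ℝ) ^ q ∂π
        ≤ ∫ z, (min (max (-g z.2 - m) 0) (n : ℝ) ^ q + L * (c z + f z.1 + g z.2)) ∂π := by
      refine integral_mono hiPπ (hiQπ.add hDi) fun z => ?_
      exact truncated_rpow_add_le (by linarith [hc0 z]) (h z.1 z.2) n.cast_nonneg hq
    rw [integral_add hiQπ hDi, integral_const_mul,
      iP (fun x => min (max (f x - m) 0) (n : ℝ) ^ q) hmP,
      iQ (fun y => min (max (-g y - m) 0) (n : ℝ) ^ q) hmQ] at hkey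
    have h5 : L * (δ / (L + 1)) ≤ δ := by
      rw [← mul_div_assoc, div_le_iff₀ (by positivity)]
      nlinarith
    have h6 := mul_le_mul_of_nonneg_left hD hL0
    linarith
  obtain ⟨hi1, hle1⟩ := integrable_rpow_of_truncated hq hu hpos
  have hdom : ∀ᵐ x ∂P, |f x - m| ^ q ≤ max (f x - m) 0 ^ q + ∫ y, c (x, y) ^ q ∂Q := by
    filter_upwards [hneg] with x hx
    rcases le_total 0 (f x - m) with h0 | h0
    · rw [abs_of_nonneg h0, max_eq_left h0]
      exact le_add_of_nonneg_right (integral_nonneg fun y => Real.rpow_nonneg (hc0 _) q)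
    · rw [abs_of_nonpos h0]
      have h7 : (-(f x - m)) ^ q ≤ max (-f x - k) 0 ^ q :=
        Real.rpow_le_rpow (by linarith) (le_max_of_le_left (by linarith)) hq0
      exact (h7.trans hx).trans
        (le_add_of_nonneg_left (Real.rpow_nonneg (le_max_right _ _) q))
  have hsum := hi1.add hcq.integral_prod_left
  have hint : Integrable (fun x => |f x - m| ^ q) P := by
    refine hsum.mono' ((Real.continuous_rpow_const hq0).comp_aestronglyMeasurable
      (continuous_abs.comp_aestronglyMeasurable hu)) ?_
    filter_upwards [hdom] with x hx
    rwa [Real.norm_of_nonneg (Real.rpow_nonneg (abs_nonneg _) q)]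
  refine ⟨hint, (integral_mono_ae hint hsum hdom).trans ?_⟩
  simp only [Pi.add_apply]
  rw [integral_add hi1 hcq.integral_prod_left, hA]
  linarith

theorem integrable_abs_rpow_of_sub_const {P : Measure X} [IsFiniteMeasure P] {q a : ℝ}
    (hq : 1 ≤ q) {f : X → ℝ} (hf : AEStronglyMeasurable f P)
    (h : Integrable (fun x => |f x - a| ^ q) P) : Integrable (fun x => |f x| ^ q) P := by
  have hq0 : 0 ≤ q := by linarith
  refine ((h.add (integrable_const (|a| ^ q))).const_mul (2 ^ (q - 1))).mono'
    ((Real.continuous_rpow_const hq0).comp_aestronglyMeasurable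
      (continuous_abs.comp_aestronglyMeasurable hf)) (ae_of_all _ fun x => ?_)
  rw [Real.norm_of_nonneg (Real.rpow_nonneg (abs_nonneg _) q)]
  refine le_trans ?_ (add_rpow_le_two_rpow_mul_add (abs_nonneg (f x - a)) (abs_nonneg a) hq)
  refine Real.rpow_le_rpow (abs_nonneg _) ?_ hq0
  simpa using abs_add_le (f x - a) a

end DualPotentials

section Coupling

variable {E : Type*} [MeasurableSpace E]

theorem isCoupling_prod (P Q : Measure E) [IsProbabilityMeasure P] [IsProbabilityMeasure Q] :
    IsCoupling (P.prod Q) P Q :=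
  ⟨measurePreserving_fst.map_eq, measurePreserving_snd.map_eq⟩

theorem IsCoupling.swap {π : Measure (E × E)} {P Q : Measure E} (hπ : IsCoupling π P Q) :
    IsCoupling (π.map Prod.swap) Q P := by
  refine ⟨?_, ?_⟩
  · rw [Measure.map_map measurable_fst measurable_swap]
    exact hπ.2
  · rw [Measure.map_map measurable_snd measurable_swap]
    exact hπ.1

end Coupling

section Potentials

variable {E : Type*} [NormedAddCommGroup E]

/-- The lower boundedness needed to read the infima as genuine ones is automatic for conjugate
pairs. -/
theorem nonneg_of_conjugate {ρ : ℝ} {ψ ψt : E → ℝ}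
    (h1 : ∀ x, ψ x = - ⨅ y : E, (‖x - y‖ ^ ρ + ψt y))
    (h2 : ∀ y, ψt y = - ⨅ x : E, (‖x - y‖ ^ ρ + ψ x)) (x y : E) :
    0 ≤ ‖x - y‖ ^ ρ + ψ x + ψt y := by
  have hbdd : BddBelow (range fun y : E => ‖x - y‖ ^ ρ + ψt y) := by
    refine ⟨min 0 (-ψ x), ?_⟩
    rintro _ ⟨y, rfl⟩
    simp only
    by_cases hy : BddBelow (range fun x : E => ‖x - y‖ ^ ρ + ψ x)
    · have := ciInf_le hy x
      have := h2 y
      exact (min_le_right _ _).trans (by linarith)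
    · have : ψt y = 0 := by rw [h2 y, Real.iInf_of_not_bddBelow hy, neg_zero]
      rw [this, add_zero]
      exact (min_le_left _ _).trans (Real.rpow_nonneg (norm_nonneg _) _)
  have := ciInf_le hbdd y
  have := h1 x
  linarith

variable [MeasurableSpace E]

/-- Couplings inherit integrability of the transport cost from the marginal moments. -/
theorem IsCoupling.integrable_norm_sub_rpow [OpensMeasurableSpace E]
    [SecondCountableTopology E] {π : Measure (E × E)} {P Q : Measure E} (hπ : IsCoupling π P Q)
    {p : ℝ} (hp : 1 ≤ p) (hP : Integrable (fun x => ‖x‖ ^ p) P)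
    (hQ : Integrable (fun y => ‖y‖ ^ p) Q) :
    Integrable (fun z : E × E => ‖z.1 - z.2‖ ^ p) π := by
  have h1 : MeasurePreserving Prod.fst π P := ⟨measurable_fst, hπ.1⟩
  have h2 : MeasurePreserving Prod.snd π Q := ⟨measurable_snd, hπ.2⟩
  have i1 : Integrable (fun z : E × E => ‖z.1‖ ^ p) π :=
    (h1.integrable_comp hP.aestronglyMeasurable).2 hP
  have i2 : Integrable (fun z : E × E => ‖z.2‖ ^ p) π :=
    (h2.integrable_comp hQ.aestronglyMeasurable).2 hQ
  have hcont : Continuous fun z : E × E => ‖z.1 - z.2‖ ^ p :=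
    (Real.continuous_rpow_const (by linarith)).comp (by fun_prop)
  refine ((i1.add i2).const_mul (2 ^ (p - 1))).mono' hcont.aestronglyMeasurable
    (ae_of_all _ fun z => ?_)
  rw [Real.norm_of_nonneg (Real.rpow_nonneg (norm_nonneg _) p)]
  exact (Real.rpow_le_rpow (norm_nonneg _) (norm_sub_le _ _) (by linarith)).trans
    (add_rpow_le_two_rpow_mul_add (norm_nonneg _) (norm_nonneg _) hp)

theorem wassersteinPow_comm (ρ : ℝ) (P Q : Measure E) :
    wassersteinPow ρ P Q = wassersteinPow ρ Q P := by
  have key : ∀ P Q : Measure E,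
      {c : ℝ | ∃ π : Measure (E × E), IsCoupling π P Q ∧ c = ∫ p, ‖p.1 - p.2‖ ^ ρ ∂π} ⊆
      {c : ℝ | ∃ π : Measure (E × E), IsCoupling π Q P ∧ c = ∫ p, ‖p.1 - p.2‖ ^ ρ ∂π} := by
    rintro P Q _ ⟨π, hπ, rfl⟩
    refine ⟨_, hπ.swap, ?_⟩
    have hmap : ∫ p, ‖p.1 - p.2‖ ^ ρ ∂(π.map Prod.swap) = ∫ p, ‖p.swap.1 - p.swap.2‖ ^ ρ ∂π :=
      (MeasurableEquiv.prodComm (α := E) (β := E)).measurableEmbedding.integral_map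
        (μ := π) (fun p : E × E => ‖p.1 - p.2‖ ^ ρ)
    rw [hmap]
    simp only [Prod.fst_swap, Prod.snd_swap, norm_sub_rev]
  exact congrArg sInf ((key P Q).antisymm (key Q P))

theorem IsKantorovichPair.symm {ρ : ℝ} {P Q : Measure E} {ψ ψt : E → ℝ}
    (h : IsKantorovichPair ρ P Q ψ ψt) : IsKantorovichPair ρ Q P ψt ψ := by
  obtain ⟨h1, h2, h3, h4, h5⟩ := h
  refine ⟨h2, h1, fun x => ?_, fun y => ?_, ?_⟩
  · simpa only [norm_sub_rev] using h4 x
  · simpa only [norm_sub_rev] using h3 y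
  · rw [wassersteinPow_comm, h5]
    ring

/-- The centered `q`-th moment of the first potential of a Kantorovich pair is bounded by the
moments of order `ρ * q`. -/
theorem IsKantorovichPair.moment_bound [OpensMeasurableSpace E] [SecondCountableTopology E]
    {ρ q : ℝ} (hρ : 1 ≤ ρ) (hq : 1 ≤ q) {P Q : Measure E} [IsProbabilityMeasure P]
    [IsProbabilityMeasure Q] (hP : Integrable (fun x => ‖x‖ ^ (ρ * q)) P)
    (hQ : Integrable (fun y => ‖y‖ ^ (ρ * q)) Q) {ψ ψt : E → ℝ}
    (hK : IsKantorovichPair ρ P Q ψ ψt) :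
    Integrable (fun x => |ψ x| ^ q) P ∧ ∫ x, |ψ x - ∫ z, ψ z ∂P| ^ q ∂P
      ≤ 2 ^ (ρ * q) * ((∫ x, ‖x‖ ^ (ρ * q) ∂P) + ∫ y, ‖y‖ ^ (ρ * q) ∂Q) := by
  obtain ⟨hψ, hψt, h1, h2, hdual⟩ := hK
  have hp : 1 ≤ ρ * q := one_le_mul_of_one_le_of_one_le hρ hq
  have hpow : ∀ t : ℝ, 0 ≤ t → (t ^ ρ) ^ q = t ^ (ρ * q) := fun t ht =>
    (Real.rpow_mul ht ρ q).symm
  have hmom : ∀ {R : Measure E} [IsProbabilityMeasure R],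
      Integrable (fun x => ‖x‖ ^ (ρ * q)) R → Integrable (fun x => ‖x‖ ^ ρ) R := by
    intro R _ hR
    have hcont : Continuous fun x : E => ‖x‖ ^ ρ :=
      (Real.continuous_rpow_const (by linarith)).comp continuous_norm
    refine ((integrable_const (1 : ℝ)).add hR).mono' hcont.aestronglyMeasurable
      (ae_of_all _ fun x => ?_)
    have h0 : 0 ≤ ‖x‖ ^ ρ := Real.rpow_nonneg (norm_nonneg _) _
    rw [Real.norm_of_nonneg h0]
    have := le_one_add_rpow h0 hq
    rwa [hpow _ (norm_nonneg _)] at this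
  have hcq := (isCoupling_prod P Q).integrable_norm_sub_rpow hp hP hQ
  have hcq' : Integrable (fun z : E × E => (‖z.1 - z.2‖ ^ ρ) ^ q) (P.prod Q) := by
    simpa only [hpow _ (norm_nonneg _)] using hcq
  have hopt : ∀ δ > 0, ∃ π : Measure (E × E), MeasurePreserving Prod.fst π P ∧
      MeasurePreserving Prod.snd π Q ∧ Integrable (fun z : E × E => ‖z.1 - z.2‖ ^ ρ) π ∧
      ∫ z, ‖z.1 - z.2‖ ^ ρ ∂π ≤ - ∫ x, ψ x ∂P - ∫ y, ψt y ∂Q + δ := by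
    intro δ hδ
    have hlt : wassersteinPow ρ P Q < - ∫ x, ψ x ∂P - ∫ y, ψt y ∂Q + δ := by linarith
    unfold wassersteinPow at hlt
    obtain ⟨_, ⟨π, hπ, rfl⟩, hlt'⟩ := exists_lt_of_csInf_lt
      (by exact ⟨_, P.prod Q, isCoupling_prod P Q, rfl⟩) hlt
    exact ⟨π, ⟨measurable_fst, hπ.1⟩, ⟨measurable_snd, hπ.2⟩,
      hπ.integrable_norm_sub_rpow hρ (hmom hP) (hmom hQ), hlt'.le⟩
  obtain ⟨hint, hle⟩ := centered_moment_le_of_dual hq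
    (c := fun z : E × E => ‖z.1 - z.2‖ ^ ρ) (fun z => Real.rpow_nonneg (norm_nonneg _) _)
    ((isCoupling_prod P Q).integrable_norm_sub_rpow hρ (hmom hP) (hmom hQ)) hcq' hψ hψt
    (nonneg_of_conjugate h1 h2) hopt
  refine ⟨integrable_abs_rpow_of_sub_const hq hψ.aestronglyMeasurable hint, hle.trans ?_⟩
  have hbound : ∫ z, (‖z.1 - z.2‖ ^ ρ) ^ q ∂(P.prod Q)
      ≤ ∫ z, 2 ^ (ρ * q - 1) * (‖z.1‖ ^ (ρ * q) + ‖z.2‖ ^ (ρ * q)) ∂(P.prod Q) := by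
    refine integral_mono hcq' (((hP.comp_fst Q).add (hQ.comp_snd P)).const_mul _) fun z => ?_
    simp only [hpow _ (norm_nonneg _)]
    exact (Real.rpow_le_rpow (norm_nonneg _) (norm_sub_le _ _) (by linarith)).trans
      (add_rpow_le_two_rpow_mul_add (norm_nonneg _) (norm_nonneg _) hp)
  rw [integral_const_mul, integral_add (hP.comp_fst Q) (hQ.comp_snd P),
    integral_fun_fst (fun x : E => ‖x‖ ^ (ρ * q)), integral_fun_snd (fun x : E => ‖x‖ ^ (ρ * q)),
    probReal_univ, probReal_univ, one_smul, one_smul, Real.rpow_sub_one two_ne_zero] at hbound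
  linarith

end Potentials

/-- integrability of the Kantorovich potentials and bound on their
generalized variances `𝒱^{1+ε}` in terms of the moments of order `ρ(1+ε)`. -/
theorem stmt2 (d : ℕ) (ρ ε : ℝ) (hρ : 1 ≤ ρ) (hε : 0 ≤ ε)
    (P Pt : Measure (EuclideanSpace ℝ (Fin d)))
    [IsProbabilityMeasure P] [IsProbabilityMeasure Pt]
    (hmomP : Integrable (fun x => ‖x‖ ^ (ρ * (1 + ε))) P)
    (hmomPt : Integrable (fun y => ‖y‖ ^ (ρ * (1 + ε))) Pt)
    (ψ ψt : EuclideanSpace ℝ (Fin d) → ℝ)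
    (hK : IsKantorovichPair ρ P Pt ψ ψt) :
    Integrable (fun x => |ψ x| ^ (1 + ε)) P ∧
    Integrable (fun y => |ψt y| ^ (1 + ε)) Pt ∧
    max (∫ x, |ψ x - ∫ z, ψ z ∂P| ^ (1 + ε) ∂P)
        (∫ y, |ψt y - ∫ z, ψt z ∂Pt| ^ (1 + ε) ∂Pt)
      ≤ 2 ^ (ρ * (1 + ε)) *
        ((∫ x, ‖x‖ ^ (ρ * (1 + ε)) ∂P) + ∫ y, ‖y‖ ^ (ρ * (1 + ε)) ∂Pt) := by
  have hq : 1 ≤ 1 + ε := by linarith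
  obtain ⟨hi, hb⟩ := hK.moment_bound hρ hq hmomP hmomPt
  obtain ⟨hi', hb'⟩ := hK.symm.moment_bound hρ hq hmomPt hmomP
  refine ⟨hi, hi', max_le hb (hb'.trans_eq ?_)⟩
  rw [add_comm (∫ y, ‖y‖ ^ (ρ * (1 + ε)) ∂Pt)]
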